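/- The set of super-stable matchings of an instance is closed under join and meet with respect to men's preferences: if M and N are super-stable matchings, then the matching M ∨ N in which each man matched in M (equivalently in N) is assigned the more preferred of his partners M(m) and N(m) (these partners are comparable, and if they are tied they are equal), is again a super-stable matching; likewise the matching M ∧ N assigning to each man the less preferred of M(m) and N(m) is a super-stable matching. -/

import Mathlib

open scoped Classical

/-- An instance of the super-stable matching problem: a finite bipartite graph with
men `A`, women `B`, edge set `E`, and for each vertex a total preorder (preference
list with ties) on its neighbors. `prefA a b b'` means `b ⪰_a b'`. -/
structure SMInstance (A B : Type*) where
  E : Finset (A × B)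
  prefA : A → B → B → Prop
  prefB : B → A → A → Prop
  prefA_refl : ∀ a b, (a, b) ∈ E → prefA a b b
  prefA_trans : ∀ a b₁ b₂ b₃, prefA a b₁ b₂ → prefA a b₂ b₃ → prefA a b₁ b₃
  prefA_total : ∀ a b₁ b₂, (a, b₁) ∈ E → (a, b₂) ∈ E → prefA a b₁ b₂ ∨ prefA a b₂ b₁
  prefB_refl : ∀ b a, (a, b) ∈ E → prefB b a a
  prefB_trans : ∀ b a₁ a₂ a₃, prefB b a₁ a₂ → prefB b a₂ a₃ → prefB b a₁ a₃
  prefB_total : ∀ b a₁ a₂, (a₁, b) ∈ E → (a₂, b) ∈ E → prefB b a₁ a₂ ∨ prefB b a₂ a₁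

namespace SMInstance

variable {A B : Type*}

/-- A matching: a set of pairwise disjoint edges of the graph. -/
def IsMatching (I : SMInstance A B) (M : Finset (A × B)) : Prop :=
  M ⊆ I.E ∧
  (∀ p ∈ M, ∀ q ∈ M, p.1 = q.1 → p = q) ∧
  (∀ p ∈ M, ∀ q ∈ M, p.2 = q.2 → p = q)

/-- `(a,b)` is a blocking edge for `M`: it is an edge outside `M`, `a` is unmatched
or weakly prefers `b` to its partner, and `b` is unmatched or weakly prefers `a` to
its partner. -/
def Blocks (I : SMInstance A B) (M : Finset (A × B)) (a : A) (b : B) : Prop :=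
  (a, b) ∈ I.E ∧ (a, b) ∉ M ∧
  (∀ b', (a, b') ∈ M → I.prefA a b b') ∧
  (∀ a', (a', b) ∈ M → I.prefB b a a')

/-- A super-stable matching: a matching with no blocking edge. -/
def SuperStable (I : SMInstance A B) (M : Finset (A × B)) : Prop :=
  I.IsMatching M ∧ ∀ a b, ¬ I.Blocks M a b

/-- `M` dominates `N`: every man matched in `N` is matched in `M` to a partner he
weakly prefers. -/
def Dominates (I : SMInstance A B) (M N : Finset (A × B)) : Prop :=
  ∀ a b, (a, b) ∈ N → ∃ b', (a, b') ∈ M ∧ I.prefA a b' b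

/-- Strict preference `b ≻_a b'`. -/
def SPrefA (I : SMInstance A B) (a : A) (b b' : B) : Prop :=
  I.prefA a b b' ∧ ¬ I.prefA a b' b

/-- Strict preference `a ≻_b a'`. -/
def SPrefB (I : SMInstance A B) (b : B) (a a' : A) : Prop :=
  I.prefB b a a' ∧ ¬ I.prefB b a' a

end SMInstance

namespace SMInstance

variable {A B : Type*} {I : SMInstance A B} {M N J K : Finset (A × B)}

theorem IsMatching.eq_right (hM : I.IsMatching M) {a : A} {b b' : B} (h : (a, b) ∈ M)
    (h' : (a, b') ∈ M) : b = b' :=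
  congrArg Prod.snd (hM.2.1 _ h _ h' rfl)

theorem IsMatching.eq_left (hM : I.IsMatching M) {a a' : A} {b : B} (h : (a, b) ∈ M)
    (h' : (a', b) ∈ M) : a = a' :=
  congrArg Prod.fst (hM.2.2 _ h _ h' rfl)

/-- `(a, b)` is an edge of `M` outside `N`, and `a` is unmatched in `N` or weakly prefers `b` to
his partner in `N`. -/
def Favors (I : SMInstance A B) (M N : Finset (A × B)) (a : A) (b : B) : Prop :=
  (a, b) ∈ M ∧ (a, b) ∉ N ∧ ∀ b', (a, b') ∈ N → I.prefA a b b'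

theorem Favors.exists_next (hM : I.SuperStable M) (hN : I.SuperStable N) {a : A} {b : B}
    (h : I.Favors M N a b) :
    ∃ a₁ b₁, I.Favors M N a₁ b₁ ∧ (a₁, b) ∈ N ∧ ¬ I.prefB b a a₁ ∧ ¬ I.prefA a₁ b b₁ := by
  obtain ⟨hab, habN, hpref⟩ := h
  obtain ⟨a₁, ha₁, hlt⟩ : ∃ a₁, (a₁, b) ∈ N ∧ ¬ I.prefB b a a₁ := by
    by_contra! hc
    exact hN.2 a b ⟨hM.1.1 hab, habN, hpref, hc⟩
  have ha₁M : (a₁, b) ∉ M := fun h' => habN (hM.1.eq_left h' hab ▸ ha₁)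
  obtain ⟨b₁, hb₁, hlt'⟩ : ∃ b₁, (a₁, b₁) ∈ M ∧ ¬ I.prefA a₁ b b₁ := by
    by_contra! hc
    refine hM.2 a₁ b ⟨hN.1.1 ha₁, ha₁M, hc, fun a' ha' => ?_⟩
    obtain rfl := hM.1.eq_left ha' hab
    exact (I.prefB_total _ _ _ (hM.1.1 hab) (hN.1.1 ha₁)).resolve_left hlt
  refine ⟨a₁, b₁, ⟨hb₁, fun h' => ha₁M (hN.1.eq_right h' ha₁ ▸ hb₁), fun b' hb' => ?_⟩,
    ha₁, hlt, hlt'⟩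
  obtain rfl := hN.1.eq_right hb' ha₁
  exact (I.prefA_total _ _ _ (hM.1.1 hb₁) (hN.1.1 ha₁)).resolve_right hlt'

/-- The map of `Favors.exists_next` is injective on a finite set, hence surjective. -/
theorem Favors.exists_prev (hM : I.SuperStable M) (hN : I.SuperStable N) {a : A} {b : B}
    (h : I.Favors M N a b) :
    ∃ a₀ b₀, I.Favors M N a₀ b₀ ∧ (a, b₀) ∈ N ∧ ¬ I.prefB b₀ a₀ a ∧ ¬ I.prefA a b₀ b := by
  have hnext : ∀ p : A × B, ∃ q : A × B, I.Favors M N p.1 p.2 →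
      I.Favors M N q.1 q.2 ∧ (q.1, p.2) ∈ N ∧ ¬ I.prefB p.2 p.1 q.1 ∧
        ¬ I.prefA q.1 p.2 q.2 := by
    intro p
    by_cases hp : I.Favors M N p.1 p.2
    · obtain ⟨a₁, b₁, h₁⟩ := hp.exists_next hM hN
      exact ⟨(a₁, b₁), fun _ => h₁⟩
    · exact ⟨p, fun hp' => absurd hp' hp⟩
  choose f hf using hnext
  let S := M.filter fun p => I.Favors M N p.1 p.2
  have hmaps : Set.MapsTo f S S := by
    intro p hp
    have hp' := (Finset.mem_filter.1 (Finset.mem_coe.1 hp)).2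
    have := (hf p hp').1
    exact Finset.mem_coe.2 (Finset.mem_filter.2 ⟨this.1, this⟩)
  have hinj : Set.InjOn f S := by
    intro p hp q hq hpq
    have hp' := (Finset.mem_filter.1 (Finset.mem_coe.1 hp)).2
    have hq' := (Finset.mem_filter.1 (Finset.mem_coe.1 hq)).2
    have h₁ := (hf p hp').2.1
    rw [hpq] at h₁
    exact hM.1.2.2 p hp'.1 q hq'.1 (hN.1.eq_right h₁ (hf q hq').2.1)
  have hsurj := Finset.surjOn_of_injOn_of_card_le f hmaps hinj le_rfl
  obtain ⟨p, hp, hpf⟩ := hsurj (Finset.mem_coe.2 (Finset.mem_filter.2 ⟨h.1, h⟩))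
  have hp' := (Finset.mem_filter.1 (Finset.mem_coe.1 hp)).2
  have := (hf p hp').2
  rw [hpf] at this
  exact ⟨p.1, p.2, hp', this⟩

theorem eq_of_tied (hM : I.SuperStable M) (hN : I.SuperStable N) {a : A} {b b' : B}
    (hb : (a, b) ∈ M) (hb' : (a, b') ∈ N) (h : I.prefA a b b') (h' : I.prefA a b' b) :
    b = b' := by
  by_contra hne
  have hfav : I.Favors M N a b := by
    refine ⟨hb, fun hc => hne (hN.1.eq_right hc hb'), fun c hc => ?_⟩
    obtain rfl := hN.1.eq_right hc hb'
    exact h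
  obtain ⟨a₀, b₀, -, hb₀, -, hlt⟩ := hfav.exists_prev hM hN
  obtain rfl := hN.1.eq_right hb₀ hb'
  exact hlt h'

/-- Each man matched in one super-stable matching is matched in every other. -/
theorem exists_partner (hM : I.SuperStable M) (hN : I.SuperStable N) {a : A} {b : B}
    (hb : (a, b) ∈ M) : ∃ b', (a, b') ∈ N := by
  by_contra! hc
  obtain ⟨_, b₀, -, hb₀, -⟩ :=
    Favors.exists_prev hM hN ⟨hb, hc b, fun b' hb' => absurd hb' (hc b')⟩
  exact hc b₀ hb₀

/-- `J` assigns to each man the more preferred of his partners in `M` and `N`. -/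
def IsJoin (I : SMInstance A B) (M N J : Finset (A × B)) : Prop :=
  ∀ a b, (a, b) ∈ J ↔
    (((a, b) ∈ M ∧ ∀ b', (a, b') ∈ N → I.prefA a b b') ∨
     ((a, b) ∈ N ∧ ∀ b', (a, b') ∈ M → I.prefA a b b'))

/-- `K` assigns to each man the less preferred of his partners in `M` and `N`. -/
def IsMeet (I : SMInstance A B) (M N K : Finset (A × B)) : Prop :=
  ∀ a b, (a, b) ∈ K ↔
    (((a, b) ∈ M ∧ ∀ b', (a, b') ∈ N → I.prefA a b' b) ∨
     ((a, b) ∈ N ∧ ∀ b', (a, b') ∈ M → I.prefA a b' b))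

theorem IsJoin.symm (hJ : I.IsJoin M N J) : I.IsJoin N M J :=
  fun a b => (hJ a b).trans or_comm

theorem IsMeet.symm (hK : I.IsMeet M N K) : I.IsMeet N M K :=
  fun a b => (hK a b).trans or_comm

/-- A man with distinct partners in `M` and `N` who weakly prefers the one in `N` favors `N`. -/
theorem favors_of_prefA (hM : I.SuperStable M) {a : A} {b b' : B}
    (hb : (a, b) ∈ M) (hb' : (a, b') ∈ N) (hbN : (a, b) ∉ N) (h : I.prefA a b' b) :
    I.Favors N M a b' := by
  refine ⟨hb', fun hc => hbN (hM.1.eq_right hc hb ▸ hb'), fun c hc => ?_⟩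
  obtain rfl := hM.1.eq_right hc hb
  exact h

theorem Favors.mem_join (hJ : I.IsJoin M N J) {a : A} {b : B} (h : I.Favors M N a b) :
    (a, b) ∈ J :=
  (hJ a b).2 (Or.inl ⟨h.1, h.2.2⟩)

theorem Favors.mem_meet (hM : I.SuperStable M) (hK : I.IsMeet M N K) {a : A} {b b' : B}
    (h : I.Favors M N a b) (hb' : (a, b') ∈ N) : (a, b') ∈ K := by
  refine (hK a b').2 (Or.inr ⟨hb', fun c hc => ?_⟩)
  obtain rfl := hM.1.eq_right hc h.1
  exact h.2.2 b' hb'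

theorem IsJoin.subset (hM : I.SuperStable M) (hN : I.SuperStable N) (hJ : I.IsJoin M N J) :
    J ⊆ I.E := by
  rintro ⟨a, b⟩ h
  rcases (hJ a b).1 h with h | h
  exacts [hM.1.1 h.1, hN.1.1 h.1]

theorem IsMeet.subset (hM : I.SuperStable M) (hN : I.SuperStable N) (hK : I.IsMeet M N K) :
    K ⊆ I.E := by
  rintro ⟨a, b⟩ h
  rcases (hK a b).1 h with h | h
  exacts [hM.1.1 h.1, hN.1.1 h.1]

theorem eq_left_of_prefA (hM : I.SuperStable M) (hN : I.SuperStable N) {a a' : A} {b : B}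
    (hab : (a, b) ∈ M) (ha'b : (a', b) ∈ N) (h : ∀ b', (a, b') ∈ N → I.prefA a b b')
    (h' : ∀ b', (a', b') ∈ M → I.prefA a' b b') : a = a' := by
  by_contra hne
  obtain ⟨x, _, -, hx, hlt, -⟩ :=
    Favors.exists_next hM hN ⟨hab, fun hc => hne (hN.1.eq_left hc ha'b), h⟩
  obtain rfl := hN.1.eq_left hx ha'b
  obtain ⟨y, _, -, hy, hlt', -⟩ :=
    Favors.exists_next hN hM ⟨ha'b, fun hc => hne (hM.1.eq_left hab hc), h'⟩
  obtain rfl := hM.1.eq_left hy hab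
  exact (I.prefB_total _ _ _ (hM.1.1 hab) (hN.1.1 ha'b)).elim hlt hlt'

/-- If the partner `a'` of a woman in `N` weakly prefers his own partner in `M` to her, then she
strictly prefers `a'` to her partner in `M`. -/
theorem not_prefB_of_prefA (hM : I.SuperStable M) (hN : I.SuperStable N) {a a' : A} {b : B}
    (hab : (a, b) ∈ M) (ha'b : (a', b) ∈ N) (hne : a ≠ a')
    (h' : ∀ b', (a', b') ∈ M → I.prefA a' b' b) : ¬ I.prefB b a a' := by
  obtain ⟨b', hb'⟩ := exists_partner hN hM ha'b
  have hfav := favors_of_prefA hN ha'b hb' (fun hc => hne (hM.1.eq_left hab hc)) (h' b' hb')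
  obtain ⟨x, b₀, hx, hb₀, hlt, -⟩ := hfav.exists_prev hM hN
  obtain rfl := hN.1.eq_right hb₀ ha'b
  obtain rfl := hM.1.eq_left hx.1 hab
  exact hlt

theorem eq_left_of_prefA_right (hM : I.SuperStable M) (hN : I.SuperStable N) {a a' : A} {b : B}
    (hab : (a, b) ∈ M) (ha'b : (a', b) ∈ N) (h : ∀ b', (a, b') ∈ N → I.prefA a b' b)
    (h' : ∀ b', (a', b') ∈ M → I.prefA a' b' b) : a = a' := by
  by_contra hne
  exact (I.prefB_total _ _ _ (hM.1.1 hab) (hN.1.1 ha'b)).elim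
    (not_prefB_of_prefA hM hN hab ha'b hne h')
    (not_prefB_of_prefA hN hM ha'b hab (Ne.symm hne) h)

theorem IsJoin.isMatching (hM : I.SuperStable M) (hN : I.SuperStable N)
    (hJ : I.IsJoin M N J) : I.IsMatching J := by
  refine ⟨hJ.subset hM hN, ?_, ?_⟩
  · rintro ⟨a, b⟩ hp ⟨a', b'⟩ hq (rfl : a = a')
    suffices b = b' by rw [this]
    rcases (hJ _ _).1 hp with ⟨h, h₁⟩ | ⟨h, h₁⟩ <;>
      rcases (hJ _ _).1 hq with ⟨h', h₁'⟩ | ⟨h', h₁'⟩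
    · exact hM.1.eq_right h h'
    · exact eq_of_tied hM hN h h' (h₁ _ h') (h₁' _ h)
    · exact eq_of_tied hN hM h h' (h₁ _ h') (h₁' _ h)
    · exact hN.1.eq_right h h'
  · rintro ⟨a, b⟩ hp ⟨a', b'⟩ hq (rfl : b = b')
    suffices a = a' by rw [this]
    rcases (hJ _ _).1 hp with ⟨h, h₁⟩ | ⟨h, h₁⟩ <;>
      rcases (hJ _ _).1 hq with ⟨h', h₁'⟩ | ⟨h', h₁'⟩
    · exact hM.1.eq_left h h'
    · exact eq_left_of_prefA hM hN h h' h₁ h₁'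
    · exact eq_left_of_prefA hN hM h h' h₁ h₁'
    · exact hN.1.eq_left h h'

theorem IsMeet.isMatching (hM : I.SuperStable M) (hN : I.SuperStable N)
    (hK : I.IsMeet M N K) : I.IsMatching K := by
  refine ⟨hK.subset hM hN, ?_, ?_⟩
  · rintro ⟨a, b⟩ hp ⟨a', b'⟩ hq (rfl : a = a')
    suffices b = b' by rw [this]
    rcases (hK _ _).1 hp with ⟨h, h₁⟩ | ⟨h, h₁⟩ <;>
      rcases (hK _ _).1 hq with ⟨h', h₁'⟩ | ⟨h', h₁'⟩
    · exact hM.1.eq_right h h'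
    · exact eq_of_tied hM hN h h' (h₁' _ h) (h₁ _ h')
    · exact eq_of_tied hN hM h h' (h₁' _ h) (h₁ _ h')
    · exact hN.1.eq_right h h'
  · rintro ⟨a, b⟩ hp ⟨a', b'⟩ hq (rfl : b = b')
    suffices a = a' by rw [this]
    rcases (hK _ _).1 hp with ⟨h, h₁⟩ | ⟨h, h₁⟩ <;>
      rcases (hK _ _).1 hq with ⟨h', h₁'⟩ | ⟨h', h₁'⟩
    · exact hM.1.eq_left h h'
    · exact eq_left_of_prefA_right hM hN h h' h₁ h₁'
    · exact eq_left_of_prefA_right hN hM h h' h₁ h₁'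
    · exact hN.1.eq_left h h'

/-- Each man matched in `M` is matched in the join, to a partner he weakly prefers. -/
theorem IsJoin.dominates (hM : I.SuperStable M) (hN : I.SuperStable N)
    (hJ : I.IsJoin M N J) : I.Dominates J M := by
  intro a b hb
  obtain ⟨b', hb'⟩ := exists_partner hM hN hb
  by_cases h : I.prefA a b b'
  · refine ⟨b, (hJ a b).2 (Or.inl ⟨hb, fun c hc => ?_⟩), I.prefA_refl _ _ (hM.1.1 hb)⟩
    rwa [hN.1.eq_right hc hb']
  · have h' := (I.prefA_total _ _ _ (hM.1.1 hb) (hN.1.1 hb')).resolve_left h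
    refine ⟨b', (hJ a b').2 (Or.inr ⟨hb', fun c hc => ?_⟩), h'⟩
    rwa [hM.1.eq_right hc hb]

/-- Each woman matched in `M` is matched in the join. -/
theorem IsJoin.exists_man (hM : I.SuperStable M) (hN : I.SuperStable N)
    (hJ : I.IsJoin M N J) {a : A} {b : B} (hb : (a, b) ∈ M) : ∃ a', (a', b) ∈ J := by
  by_contra! hc
  obtain ⟨b', hb', hpref⟩ := hJ.dominates hM hN a b hb
  have hne : b' ≠ b := fun h => hc a (h ▸ hb')
  rcases (hJ a b').1 hb' with ⟨h, -⟩ | ⟨h, h₁⟩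
  · exact hne (hM.1.eq_right h hb)
  · have hfav : I.Favors N M a b' := ⟨h, fun h' => hne (hM.1.eq_right h' hb), h₁⟩
    obtain ⟨x, b₀, hx, hb₀, -⟩ := hfav.exists_prev hN hM
    obtain rfl := hM.1.eq_right hb₀ hb
    exact hc x (hx.mem_join hJ.symm)

/-- Each woman matched in `M` is matched in the meet, to a partner she weakly prefers. -/
theorem IsMeet.exists_man (hM : I.SuperStable M) (hN : I.SuperStable N)
    (hK : I.IsMeet M N K) {a : A} {b : B} (hb : (a, b) ∈ M) :
    ∃ a', (a', b) ∈ K ∧ I.prefB b a' a := by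
  by_cases hab : (a, b) ∈ K
  · exact ⟨a, hab, I.prefB_refl _ _ (hM.1.1 hb)⟩
  obtain ⟨b', hb'⟩ := exists_partner hM hN hb
  have hlt : ¬ I.prefA a b' b := fun h => hab <| (hK a b).2 <| Or.inl ⟨hb, fun c hc => by
    rwa [hN.1.eq_right hc hb']⟩
  have hle := (I.prefA_total _ _ _ (hM.1.1 hb) (hN.1.1 hb')).resolve_right hlt
  have hfav : I.Favors M N a b := by
    refine ⟨hb, fun hc => hlt ?_, fun c hc => by rwa [hN.1.eq_right hc hb']⟩
    obtain rfl := hN.1.eq_right hc hb'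
    exact I.prefA_refl _ _ (hM.1.1 hb)
  obtain ⟨x, b₁, hx, hxb, hlt', -⟩ := hfav.exists_next hM hN
  exact ⟨x, hx.mem_meet hM hK hxb,
    (I.prefB_total _ _ _ (hM.1.1 hb) (hN.1.1 hxb)).resolve_left hlt'⟩

/-- A blocking edge of the join blocks `M` if the woman's partner in the join, if any, is also
her partner in `M`. -/
theorem IsJoin.blocks (hM : I.SuperStable M) (hN : I.SuperStable N) (hJ : I.IsJoin M N J)
    {a : A} {b : B} (h : I.Blocks J a b) (hb : ∀ x, (x, b) ∈ M → (x, b) ∈ J) :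
    I.Blocks M a b := by
  obtain ⟨hE, hab, hA, hB⟩ := h
  refine ⟨hE, fun hc => hab (hb a hc), fun b' hb' => ?_, fun x hx => hB x (hb x hx)⟩
  obtain ⟨c, hc, hcb⟩ := hJ.dominates hM hN a b' hb'
  exact I.prefA_trans _ _ _ _ (hA c hc) hcb

theorem IsJoin.superStable (hM : I.SuperStable M) (hN : I.SuperStable N)
    (hJ : I.IsJoin M N J) : I.SuperStable J := by
  refine ⟨hJ.isMatching hM hN, fun a b h => ?_⟩
  by_cases hb : ∀ x, (x, b) ∈ M → (x, b) ∈ J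
  · exact hM.2 a b (hJ.blocks hM hN h hb)
  push Not at hb
  obtain ⟨x, hxM, hxJ⟩ := hb
  obtain ⟨y, hy⟩ := hJ.exists_man hM hN hxM
  rcases (hJ y b).1 hy with ⟨hyM, -⟩ | ⟨hyN, -⟩
  · exact hxJ (hM.1.eq_left hyM hxM ▸ hy)
  · exact hN.2 a b (hJ.symm.blocks hN hM h fun z hz => hN.1.eq_left hyN hz ▸ hy)

/-- A blocking edge of the meet blocks `M` if the man's partner in `M`, if any, is also his
partner in the meet. -/
theorem IsMeet.blocks (hM : I.SuperStable M) (hN : I.SuperStable N) (hK : I.IsMeet M N K)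
    {a : A} {b : B} (h : I.Blocks K a b) (ha : ∀ c, (a, c) ∈ M → (a, c) ∈ K) :
    I.Blocks M a b := by
  obtain ⟨hE, hab, hA, hB⟩ := h
  refine ⟨hE, fun hc => hab (ha b hc), fun c hc => hA c (ha c hc), fun x hx => ?_⟩
  obtain ⟨y, hy, hyx⟩ := hK.exists_man hM hN hx
  exact I.prefB_trans _ _ _ _ (hB y hy) hyx

theorem IsMeet.superStable (hM : I.SuperStable M) (hN : I.SuperStable N)
    (hK : I.IsMeet M N K) : I.SuperStable K := by
  refine ⟨hK.isMatching hM hN, fun a b h => ?_⟩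
  by_cases ha : ∀ c, (a, c) ∈ M → (a, c) ∈ K
  · exact hM.2 a b (hK.blocks hM hN h ha)
  push Not at ha
  obtain ⟨c, hcM, hcK⟩ := ha
  refine hN.2 a b (hK.symm.blocks hN hM h fun d hd => (hK a d).2 (Or.inr ⟨hd, fun e he => ?_⟩))
  obtain rfl := hM.1.eq_right he hcM
  refine (I.prefA_total _ _ _ (hM.1.1 hcM) (hN.1.1 hd)).resolve_right fun hle => ?_
  exact hcK ((hK a e).2 (Or.inl ⟨hcM, fun d' hd' => by rwa [hN.1.eq_right hd' hd]⟩))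

end SMInstance

/-- The set of super-stable matchings is closed under join and meet with respect to
men's preferences: for super-stable matchings `M, N`, the partners of any man in `M`
and `N` are comparable (and equal if tied), the matching `J = M ∨ N` assigning each
matched man the more preferred of his two partners is super-stable, and the matching
`K = M ∧ N` assigning each matched man the less preferred partner is super-stable. -/
theorem super_stable_lattice {A B : Type*} (I : SMInstance A B)
    (M N J K : Finset (A × B)) (hM : I.SuperStable M) (hN : I.SuperStable N)
    (hJ : ∀ a b, (a, b) ∈ J ↔
      (((a, b) ∈ M ∧ ∀ b', (a, b') ∈ N → I.prefA a b b') ∨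
       ((a, b) ∈ N ∧ ∀ b', (a, b') ∈ M → I.prefA a b b')))
    (hK : ∀ a b, (a, b) ∈ K ↔
      (((a, b) ∈ M ∧ ∀ b', (a, b') ∈ N → I.prefA a b' b) ∨
       ((a, b) ∈ N ∧ ∀ b', (a, b') ∈ M → I.prefA a b' b))) :
    (∀ a b b', (a, b) ∈ M → (a, b') ∈ N →
      (I.prefA a b b' ∨ I.prefA a b' b) ∧ ((I.prefA a b b' ∧ I.prefA a b' b) → b = b')) ∧
    I.SuperStable J ∧ I.SuperStable K := by
  exact ⟨fun a b b' hb hb' => ⟨I.prefA_total _ _ _ (hM.1.1 hb) (hN.1.1 hb'),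
      fun h => SMInstance.eq_of_tied hM hN hb hb' h.1 h.2⟩,
    SMInstance.IsJoin.superStable hM hN hJ, SMInstance.IsMeet.superStable hM hN hK⟩
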